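/- Let M = [[A,B],[C,D]] be a 2N×2N real free symplectic matrix (A·Bᵀ = B·Aᵀ, C·Dᵀ = D·Cᵀ, A·Dᵀ − B·Cᵀ = I_N, det B ≠ 0) and let f, g : ℝᴺ → ℂ be Schwartz functions. Define z(t) = (f ⋆^M g)(t) = ∫_{ℝᴺ} f(τ) · g(t θ τ) dτ, where g(t θ τ) is the M-generalized translation of g. Then for every u ∈ ℝᴺ, L_M[z](u) = L_M[f](u) · L_M[g](u). -/

import Mathlib

open MeasureTheory Matrix Complex

/-- The free metaplectic transform (FMT) of `f : ℝᴺ → ℂ` with respect to the blocks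
`A`, `B`, `D` of a free symplectic matrix `M = [[A,B],[C,D]]`:
`L_M[f](u) = |det B|^(−1/2) ∫ f(t) · exp(πi(u D B⁻¹ uᵀ + t B⁻¹ A tᵀ) − 2πi t B⁻¹ uᵀ) dt`. -/
noncomputable def fmt {N : ℕ} (A B D : Matrix (Fin N) (Fin N) ℝ)
    (f : (Fin N → ℝ) → ℂ) (u : Fin N → ℝ) : ℂ :=
  (((Real.sqrt |B.det|)⁻¹ : ℝ) : ℂ) *
    ∫ t : Fin N → ℝ,
      f t * Complex.exp (↑Real.pi * Complex.I *
          (↑(u ⬝ᵥ ((D * B⁻¹) *ᵥ u)) + ↑(t ⬝ᵥ ((B⁻¹ * A) *ᵥ t)))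
        - 2 * ↑Real.pi * Complex.I * ↑(t ⬝ᵥ (B⁻¹ *ᵥ u)))

/-- The `M`-generalized translation of `g` by `τ`:
`g(t θ τ) = |det B|⁻¹ ∫ L_M[g](u) · exp(πi(τ B⁻¹ A τᵀ − t B⁻¹ A tᵀ) + 2πi (t−τ) B⁻¹ uᵀ) du`. -/
noncomputable def genTrans {N : ℕ} (A B D : Matrix (Fin N) (Fin N) ℝ)
    (g : (Fin N → ℝ) → ℂ) (t τ : Fin N → ℝ) : ℂ :=
  ((|B.det|⁻¹ : ℝ) : ℂ) *
    ∫ u : Fin N → ℝ,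
      fmt A B D g u * Complex.exp (↑Real.pi * Complex.I *
          (↑(τ ⬝ᵥ ((B⁻¹ * A) *ᵥ τ)) - ↑(t ⬝ᵥ ((B⁻¹ * A) *ᵥ t)))
        + 2 * ↑Real.pi * Complex.I * ↑((t - τ) ⬝ᵥ (B⁻¹ *ᵥ u)))

open scoped FourierTransform SchwartzMap Convolution

/-- The chirp `t ↦ exp(πi t Q tᵀ)` attached to a real square matrix `Q`. -/
noncomputable def chirp {N : ℕ} (Q : Matrix (Fin N) (Fin N) ℝ) (t : Fin N → ℝ) : ℂ :=
  Complex.exp (↑Real.pi * Complex.I * ↑(t ⬝ᵥ (Q *ᵥ t)))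

theorem chirp_ne_zero {N : ℕ} (Q : Matrix (Fin N) (Fin N) ℝ) (t : Fin N → ℝ) :
    chirp Q t ≠ 0 :=
  Complex.exp_ne_zero _

theorem hasTemperateGrowth_cexp_ofReal_mul_I :
    Function.HasTemperateGrowth (fun s : ℝ => Complex.exp (Complex.I * s)) := by
  have hderiv (n : ℕ) : iteratedDeriv n (fun s : ℝ => Complex.exp (Complex.I * s)) =
      fun s : ℝ => Complex.I ^ n * Complex.exp (Complex.I * s) := by
    induction n with
    | zero => simp
    | succ n ih =>
      rw [iteratedDeriv_succ, ih]
      funext s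
      have h : HasDerivAt (fun s : ℝ => Complex.I * (s : ℂ)) (Complex.I * 1) s :=
        (Complex.ofRealCLM.hasDerivAt).const_mul _
      rw [(h.cexp.const_mul _).deriv]
      ring
  refine ⟨Complex.contDiff_exp.comp (contDiff_const.mul Complex.ofRealCLM.contDiff),
    fun n => ⟨0, 1, fun s => ?_⟩⟩
  rw [norm_iteratedFDeriv_eq_norm_iteratedDeriv, hderiv]
  simp [mul_comm Complex.I (s : ℂ), Complex.norm_exp_ofReal_mul_I]

theorem hasTemperateGrowth_chirp {N : ℕ} (Q : Matrix (Fin N) (Fin N) ℝ) :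
    Function.HasTemperateGrowth (fun x : EuclideanSpace ℝ (Fin N) => chirp Q x.ofLp) := by
  have hcoord (i : Fin N) :
      Function.HasTemperateGrowth (fun x : EuclideanSpace ℝ (Fin N) => x.ofLp i) :=
    (EuclideanSpace.proj (𝕜 := ℝ) i).hasTemperateGrowth
  have hquad : Function.HasTemperateGrowth
      (fun x : EuclideanSpace ℝ (Fin N) => Real.pi * (x.ofLp ⬝ᵥ (Q *ᵥ x.ofLp))) := by
    simp only [dotProduct, mulVec]
    refine (Function.HasTemperateGrowth.const _).fun_mul (.sum fun i _ => ?_)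
    exact (hcoord i).fun_mul
      (.sum fun j _ => (Function.HasTemperateGrowth.const _).fun_mul (hcoord j))
  convert hasTemperateGrowth_cexp_ofReal_mul_I.comp hquad using 1
  funext x
  simp only [chirp, Function.comp_apply]
  push_cast
  ring_nf

/-- The Schwartz function `f · chirp Q`, transported to Euclidean space. -/
noncomputable def chirpMul {N : ℕ} (Q : Matrix (Fin N) (Fin N) ℝ)
    (f : 𝓢(Fin N → ℝ, ℂ)) : 𝓢(EuclideanSpace ℝ (Fin N), ℂ) :=
  SchwartzMap.smulLeftCLM ℂ (fun x : EuclideanSpace ℝ (Fin N) => chirp Q x.ofLp)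
    (SchwartzMap.compCLMOfContinuousLinearEquiv ℂ (EuclideanSpace.equiv (Fin N) ℝ) f)

theorem chirpMul_apply {N : ℕ} (Q : Matrix (Fin N) (Fin N) ℝ)
    (f : 𝓢(Fin N → ℝ, ℂ)) (x : EuclideanSpace ℝ (Fin N)) :
    chirpMul Q f x = f x.ofLp * chirp Q x.ofLp := by
  rw [chirpMul, SchwartzMap.smulLeftCLM_apply_apply (hasTemperateGrowth_chirp Q), mul_comm]
  rfl

theorem integral_ofLp {N : ℕ} (F : (Fin N → ℝ) → ℂ) :
    ∫ x : EuclideanSpace ℝ (Fin N), F x.ofLp = ∫ t, F t :=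
  (EuclideanSpace.volume_preserving_symm_measurableEquiv_toLp (Fin N)).integral_comp' F

theorem inner_toLp {N : ℕ} (x : EuclideanSpace ℝ (Fin N)) (w : Fin N → ℝ) :
    inner ℝ x (WithLp.toLp 2 w) = x.ofLp ⬝ᵥ w := by
  rw [EuclideanSpace.inner_eq_star_dotProduct, dotProduct_comm]
  simp

theorem integral_mulVec {N : ℕ} {M : Matrix (Fin N) (Fin N) ℝ} (hM : M.det ≠ 0)
    (F : (Fin N → ℝ) → ℂ) :
    ((|M.det| : ℝ) : ℂ) * ∫ t, F (M *ᵥ t) = ∫ t, F t := by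
  have hemb : MeasurableEmbedding (Matrix.toLin' M) :=
    (LinearEquiv.ofIsUnitDet (f := Matrix.toLin' M) (v := Pi.basisFun ℝ (Fin N))
      (v' := Pi.basisFun ℝ (Fin N)) (by simpa using hM)).toContinuousLinearEquiv
        |>.toHomeomorph.measurableEmbedding
  have h := hemb.integral_map (μ := volume) F
  rw [Real.map_matrix_volume_pi_eq_smul_volume_pi hM, integral_smul_measure,
    ENNReal.toReal_ofReal (abs_nonneg _)] at h
  simp only [Matrix.toLin'_apply] at h
  rw [← h, abs_inv, Complex.real_smul, ← mul_assoc, ← Complex.ofReal_mul,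
    mul_inv_cancel₀ (abs_ne_zero.2 hM)]
  simp

theorem Real.fourier_const_smul {V E : Type*} [NormedAddCommGroup V] [InnerProductSpace ℝ V]
    [FiniteDimensional ℝ V] [MeasurableSpace V] [BorelSpace V] [NormedAddCommGroup E]
    [NormedSpace ℂ E]
    (c : ℂ) (f : V → E) : 𝓕 (c • f) = c • 𝓕 f :=
  VectorFourier.fourierIntegral_const_smul _ _ _ f c

theorem fmt_eq_fourier {N : ℕ} (A B D : Matrix (Fin N) (Fin N) ℝ)
    (f : (Fin N → ℝ) → ℂ) (u : Fin N → ℝ) :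
    fmt A B D f u = (((Real.sqrt |B.det|)⁻¹ : ℝ) : ℂ) * chirp (D * B⁻¹) u *
      𝓕 (fun x : EuclideanSpace ℝ (Fin N) => f x.ofLp * chirp (B⁻¹ * A) x.ofLp)
        (WithLp.toLp 2 (B⁻¹ *ᵥ u)) := by
  rw [fmt, Real.fourier_eq', ← integral_ofLp, ← integral_const_mul, ← integral_const_mul]
  refine integral_congr_ae (.of_forall fun x => ?_)
  beta_reduce
  rw [inner_toLp, chirp, chirp, smul_eq_mul, Complex.exp_sub, mul_add, Complex.exp_add,
    div_eq_mul_inv, ← Complex.exp_neg]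
  push_cast
  ring_nf

/-- The Schwartz function `H` for which `genTrans A B D g t τ` is, up to chirps, `H (t - τ)`. -/
noncomputable def genTransKernel {N : ℕ} (A B D : Matrix (Fin N) (Fin N) ℝ)
    (g : 𝓢(Fin N → ℝ, ℂ)) : 𝓢(EuclideanSpace ℝ (Fin N), ℂ) :=
  𝓕⁻ (SchwartzMap.smulLeftCLM ℂ
    (fun x : EuclideanSpace ℝ (Fin N) => chirp (Bᵀ * (D * B⁻¹) * B) x.ofLp)
    (𝓕 (chirpMul (B⁻¹ * A) g)))

theorem chirp_conj {N : ℕ} (Q B : Matrix (Fin N) (Fin N) ℝ) (t : Fin N → ℝ) :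
    chirp (Bᵀ * Q * B) t = chirp Q (B *ᵥ t) := by
  rw [chirp, chirp, ← mulVec_mulVec, ← mulVec_mulVec, dotProduct_mulVec, vecMul_transpose]

theorem mulVec_inv_mulVec {N : ℕ} {B : Matrix (Fin N) (Fin N) ℝ} (hB : B.det ≠ 0)
    (u : Fin N → ℝ) : B *ᵥ (B⁻¹ *ᵥ u) = u := by
  rw [mulVec_mulVec, mul_nonsing_inv _ hB.isUnit, one_mulVec]

theorem fourier_genTransKernel {N : ℕ} (A B D : Matrix (Fin N) (Fin N) ℝ)
    (hB : B.det ≠ 0) (g : 𝓢(Fin N → ℝ, ℂ)) (u : Fin N → ℝ) :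
    (((Real.sqrt |B.det|)⁻¹ : ℝ) : ℂ) *
      𝓕 (genTransKernel A B D g : EuclideanSpace ℝ (Fin N) → ℂ) (WithLp.toLp 2 (B⁻¹ *ᵥ u)) =
      fmt A B D g u := by
  rw [← SchwartzMap.fourier_coe, genTransKernel, FourierTransform.fourier_fourierInv_eq,
    SchwartzMap.smulLeftCLM_apply_apply (hasTemperateGrowth_chirp _), chirp_conj,
    mulVec_inv_mulVec hB, fmt_eq_fourier, smul_eq_mul, mul_assoc, SchwartzMap.fourier_coe]
  simp only [funext (chirpMul_apply (B⁻¹ * A) g)]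

theorem genTrans_eq {N : ℕ} (A B D : Matrix (Fin N) (Fin N) ℝ)
    (hB : B.det ≠ 0) (g : 𝓢(Fin N → ℝ, ℂ)) (t τ : Fin N → ℝ) :
    genTrans A B D g t τ = (((Real.sqrt |B.det|)⁻¹ : ℝ) : ℂ) *
      (chirp (B⁻¹ * A) τ * (chirp (B⁻¹ * A) t)⁻¹ *
        genTransKernel A B D g (WithLp.toLp 2 (t - τ))) := by
  have hinv : genTransKernel A B D g (WithLp.toLp 2 (t - τ)) =
      ∫ v : Fin N → ℝ, Complex.exp (2 * Real.pi * Complex.I * ((t - τ) ⬝ᵥ v : ℝ)) *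
        𝓕 (genTransKernel A B D g : EuclideanSpace ℝ (Fin N) → ℂ) (WithLp.toLp 2 v) := by
    rw [← integral_ofLp]
    nth_rw 1 [← FourierTransform.fourierInv_fourier_eq
      (F := 𝓢(EuclideanSpace ℝ (Fin N), ℂ)) (genTransKernel A B D g)]
    rw [SchwartzMap.fourierInv_coe, Real.fourierInv_eq', SchwartzMap.fourier_coe]
    congr 1
    funext x
    rw [inner_toLp, dotProduct_comm, smul_eq_mul]
    push_cast
    ring_nf
  have hB' : B⁻¹.det ≠ 0 := by simpa [det_nonsing_inv] using hB
  rw [← integral_mulVec hB', det_nonsing_inv, Ring.inverse_eq_inv', abs_inv] at hinv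
  rw [genTrans, hinv]
  simp only [← integral_const_mul]
  refine integral_congr_ae (.of_forall fun u => ?_)
  beta_reduce
  rw [← fourier_genTransKernel A B D hB, Complex.exp_add, mul_sub, Complex.exp_sub, chirp, chirp]
  ring

/-- Convolution theorem of the first kind: with
`z(t) = (f ⋆^M g)(t) = ∫ f(τ) g(t θ τ) dτ`, one has `L_M[z](u) = L_M[f](u) · L_M[g](u)`. -/
theorem fmt_convolution_first_kind {N : ℕ} (A B C D : Matrix (Fin N) (Fin N) ℝ)
    (h1 : A * Bᵀ = B * Aᵀ) (h2 : C * Dᵀ = D * Cᵀ)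
    (h3 : A * Dᵀ - B * Cᵀ = 1) (hB : B.det ≠ 0)
    (f g : SchwartzMap ((Fin N) → ℝ) ℂ) (u : Fin N → ℝ) :
    fmt A B D (fun t => ∫ τ : Fin N → ℝ, f τ * genTrans A B D (⇑g) t τ) u
      = fmt A B D (⇑f) u * fmt A B D (⇑g) u := by
  have hconv : (fun x : EuclideanSpace ℝ (Fin N) =>
      (∫ τ : Fin N → ℝ, f τ * genTrans A B D (⇑g) x.ofLp τ) * chirp (B⁻¹ * A) x.ofLp) =
      (((Real.sqrt |B.det|)⁻¹ : ℝ) : ℂ) • ((chirpMul (B⁻¹ * A) f)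
        ⋆[ContinuousLinearMap.mul ℂ ℂ] (genTransKernel A B D g)) := by
    funext x
    rw [Pi.smul_apply, smul_eq_mul, convolution_def, ← integral_ofLp, ← integral_mul_const,
      ← integral_const_mul]
    congr 1
    funext y
    rw [genTrans_eq A B D hB, ContinuousLinearMap.mul_apply', chirpMul_apply]
    have := chirp_ne_zero (B⁻¹ * A) x.ofLp
    field_simp
    rfl
  rw [fmt_eq_fourier A B D (fun t => _), hconv, Real.fourier_const_smul,
    Pi.smul_apply, Real.fourier_mul_convolution_eq (SchwartzMap.integrable _)
      (SchwartzMap.integrable _), ← fourier_genTransKernel A B D hB g, fmt_eq_fourier,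
    funext (chirpMul_apply (B⁻¹ * A) f), smul_eq_mul]
  ring
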